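/- Let Λ = U³ ⊕ E8² ⊕ ⟨−2⟩ and let ι, ι′ ∈ O(Λ) be involutions whose invariant sublattices Λ^ι and Λ^{ι′} are both isometric to U(2). Then ι and ι′ are conjugate in O(Λ): there exists γ ∈ O(Λ) with ι′ = γ ∘ ι ∘ γ⁻¹. -/

import Mathlib

open Matrix

/-- The Gram pairing `(x, y) ↦ xᵀ G y` of an integer matrix `G`, as a bilinear map. -/
def gramBilin {n : ℕ} (G : Matrix (Fin n) (Fin n) ℤ) :
    (Fin n → ℤ) →ₗ[ℤ] (Fin n → ℤ) →ₗ[ℤ] ℤ :=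
  Matrix.toLinearMap₂' ℤ G

/-- The hyperbolic plane `U`, with Gram matrix `[[0,1],[1,0]]`. -/
def UGram : Matrix (Fin 2) (Fin 2) ℤ := !![0, 1; 1, 0]

/-- `U(2)`, with Gram matrix `[[0,2],[2,0]]`. -/
def U2Gram : Matrix (Fin 2) (Fin 2) ℤ := !![0, 2; 2, 0]

/-- `⟨2⟩ ⊕ ⟨-2⟩`. -/
def diag2Gram : Matrix (Fin 2) (Fin 2) ℤ := !![2, 0; 0, -2]

/-- The (negative definite even unimodular) `E8` lattice: the negative of the E₈ Cartan matrix. -/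
def E8Gram : Matrix (Fin 8) (Fin 8) ℤ := -CartanMatrix.E₈

/-- The rank-one lattice `⟨k⟩`. -/
def rankOneGram (k : ℤ) : Matrix (Fin 1) (Fin 1) ℤ := !![k]

/-- Orthogonal direct sum of two bilinear forms, on the product module. -/
def prodBilin {M N : Type*} [AddCommGroup M] [AddCommGroup N] [Module ℤ M] [Module ℤ N]
    (BM : M →ₗ[ℤ] M →ₗ[ℤ] ℤ) (BN : N →ₗ[ℤ] N →ₗ[ℤ] ℤ) :
    (M × N) →ₗ[ℤ] (M × N) →ₗ[ℤ] ℤ :=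
  LinearMap.mk₂ ℤ (fun x y => BM x.1 y.1 + BN x.2 y.2)
    (by intro m₁ m₂ n; simp [map_add]; ring)
    (by intro c m n; simp [_root_.map_smul, smul_eq_mul]; ring)
    (by intro m n₁ n₂; simp [map_add]; ring)
    (by intro c m n; simp [_root_.map_smul, smul_eq_mul]; ring)

/-- The underlying module of `Λ = U³ ⊕ E8² ⊕ ⟨-2⟩`. -/
abbrev LambdaM : Type :=
  (Fin 2 → ℤ) × (Fin 2 → ℤ) × (Fin 2 → ℤ) × (Fin 8 → ℤ) × (Fin 8 → ℤ) × (Fin 1 → ℤ)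

/-- The bilinear form of the Beauville–Bogomolov lattice `Λ = U³ ⊕ E8² ⊕ ⟨-2⟩`. -/
def LambdaB : LambdaM →ₗ[ℤ] LambdaM →ₗ[ℤ] ℤ :=
  prodBilin (gramBilin UGram) <| prodBilin (gramBilin UGram) <| prodBilin (gramBilin UGram) <|
    prodBilin (gramBilin E8Gram) <| prodBilin (gramBilin E8Gram) (gramBilin (rankOneGram (-2)))

/-- Membership in `O(Λ)`: a linear automorphism preserving the form. -/
def IsIsometry (f : LambdaM ≃ₗ[ℤ] LambdaM) : Prop :=
  ∀ x y, LambdaB (f x) (f y) = LambdaB x y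

/-- The invariant sublattice `Λ^ι = {x | ι x = x}`. -/
def invLattice (f : LambdaM ≃ₗ[ℤ] LambdaM) : Submodule ℤ LambdaM :=
  LinearMap.eqLocus (f : LambdaM →ₗ[ℤ] LambdaM) (LinearMap.id)

/-- A submodule of `Λ`, with the restricted form, is isometric to the lattice `(N, BN)`. -/
def IsometricTo {N : Type*} [AddCommGroup N] [Module ℤ N]
    (K : Submodule ℤ LambdaM) (BN : N →ₗ[ℤ] N →ₗ[ℤ] ℤ) : Prop :=
  ∃ e : K ≃ₗ[ℤ] N, ∀ x y : K, BN (e x) (e y) = LambdaB (x : LambdaM) (y : LambdaM)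

/-- `div_Λ(v) = d`: the ideal of values `B(v, ·)` is generated by the positive integer `d`. -/
def HasDivisibility (v : LambdaM) (d : ℤ) : Prop :=
  0 < d ∧ (∀ x, d ∣ LambdaB v x) ∧ ∃ x, LambdaB v x = d

/-- Conjugacy in `O(Λ)`: `ι' = γ ∘ ι ∘ γ⁻¹` for some isometry `γ`. -/
def ConjInO (ι ι' : LambdaM ≃ₗ[ℤ] LambdaM) : Prop :=
  ∃ γ : LambdaM ≃ₗ[ℤ] LambdaM, IsIsometry γ ∧ ∀ x, ι' x = γ (ι (γ.symm x))

/-- A sublattice has signature (1,1): rank two, containing both an element of positive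
square and an element of negative square. -/
def SigOneOne (K : Submodule ℤ LambdaM) : Prop :=
  Module.finrank ℤ K = 2 ∧ (∃ x ∈ K, 0 < LambdaB x x) ∧ (∃ x ∈ K, LambdaB x x < 0)

/-- The orthogonal complement of a submodule of `Λ`. -/
def perpOf (K : Submodule ℤ LambdaM) : Submodule ℤ LambdaM where
  carrier := {x | ∀ s ∈ K, LambdaB x s = 0}
  add_mem' := by
    intro a b ha hb s hs
    simp [map_add, LinearMap.add_apply, ha s hs, hb s hs]
  zero_mem' := by
    intro s hs
    simp
  smul_mem' := by
    intro c a ha s hs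
    simp only [_root_.map_smul, LinearMap.smul_apply, ha s hs, smul_zero]

section Isometries

variable {L : Type*} [AddCommGroup L]

/-- The group of isometries of a bilinear form on an abelian group. -/
def isometryGroup (B : L →ₗ[ℤ] L →ₗ[ℤ] ℤ) : Subgroup (L ≃ₗ[ℤ] L) where
  carrier := {g | ∀ x y, B (g x) (g y) = B x y}
  mul_mem' := by
    intro g h hg hh x y
    simp only [LinearEquiv.mul_apply]
    rw [hg, hh]
  one_mem' := fun _ _ => rfl
  inv_mem' := by
    intro g hg x y
    rw [← hg]
    simp

/-- The Eichler transvection attached to an isotropic vector `e` and a vector `a` orthogonal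
to `e` with `B(a, a) = 2n`. -/
theorem exists_eichler_transvection {B : L →ₗ[ℤ] L →ₗ[ℤ] ℤ} (hB : ∀ x y, B x y = B y x)
    {e a : L} {n : ℤ} (he : B e e = 0) (hea : B e a = 0) (ha : B a a = 2 * n) :
    ∃ g ∈ isometryGroup B, ∀ x, g x = x - B a x • e + B e x • a - (n * B e x) • e := by
  have hae : B a e = 0 := by rw [hB, hea]
  let t : L → ℤ → L →ₗ[ℤ] L := fun a n =>
    LinearMap.id - (B a).smulRight e + (B e).smulRight a - (n • B e).smulRight e
  have ht : ∀ a n x, t a n x = x - B a x • e + B e x • a - (n * B e x) • e := by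
    intro a n x
    simp [t]
  let g : L ≃ₗ[ℤ] L := LinearEquiv.ofLinearMap (t a n) (t (-a) n)
    (by
      ext x
      simp only [LinearMap.comp_apply, LinearMap.id_apply, ht, map_sub, map_add, map_smul,
        map_neg, LinearMap.neg_apply, he, hea, hae, ha, smul_eq_mul]
      module)
    (by
      ext x
      simp only [LinearMap.comp_apply, LinearMap.id_apply, ht, map_sub, map_add, map_smul,
        map_neg, LinearMap.neg_apply, he, hea, hae, ha, smul_eq_mul]
      module)
  have hg : ∀ x, g x = x - B a x • e + B e x • a - (n * B e x) • e := ht a n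
  refine ⟨g, fun x y => ?_, hg⟩
  simp only [hg, map_sub, map_add, map_smul, LinearMap.sub_apply, LinearMap.add_apply,
    LinearMap.smul_apply, he, hea, hae, ha, smul_eq_mul, hB x e, hB x a]
  ring

/-- The reflection in a vector of square `-2`. -/
theorem exists_reflection {B : L →ₗ[ℤ] L →ₗ[ℤ] ℤ} (hB : ∀ x y, B x y = B y x)
    {r : L} (hr : B r r = -2) :
    ∃ g ∈ isometryGroup B, ∀ x, g x = x + B r x • r := by
  let t : L →ₗ[ℤ] L := LinearMap.id + (B r).smulRight r
  have ht : ∀ x, t x = x + B r x • r := fun x => by simp [t]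
  have htt : t ∘ₗ t = LinearMap.id := by
    ext x
    simp only [LinearMap.comp_apply, LinearMap.id_apply, ht, map_add, map_smul, hr, smul_eq_mul]
    module
  let g : L ≃ₗ[ℤ] L := LinearEquiv.ofLinearMap t t htt htt
  have hg : ∀ x, g x = x + B r x • r := ht
  refine ⟨g, fun x y => ?_, hg⟩
  simp only [hg, map_add, map_smul, LinearMap.add_apply, LinearMap.smul_apply, hr, smul_eq_mul,
    hB x r]
  ring

/-- A symmetric even form together with two orthogonal hyperbolic pairs `(e₁, f₁)` and
`(e₂, f₂)`. -/
structure HyperbolicPairs (B : L →ₗ[ℤ] L →ₗ[ℤ] ℤ) (e₁ f₁ e₂ f₂ : L) : Prop where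
  symm : ∀ x y, B x y = B y x
  even : ∀ x, Even (B x x)
  e₁e₁ : B e₁ e₁ = 0
  f₁f₁ : B f₁ f₁ = 0
  e₁f₁ : B e₁ f₁ = 1
  e₂e₂ : B e₂ e₂ = 0
  f₂f₂ : B f₂ f₂ = 0
  e₂f₂ : B e₂ f₂ = 1
  e₁e₂ : B e₁ e₂ = 0
  e₁f₂ : B e₁ f₂ = 0
  f₁e₂ : B f₁ e₂ = 0
  f₁f₂ : B f₁ f₂ = 0

/-- Two isotropic vectors `h` and `e` having pairing `1` with the same isotropic vector `f` are
related by an isometry fixing every vector orthogonal to `f` and to `h - e`. -/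
theorem exists_isometry_of_pairing_eq_one {B : L →ₗ[ℤ] L →ₗ[ℤ] ℤ} (hB : ∀ x y, B x y = B y x)
    {e f h : L} (he : B e e = 0) (hf : B f f = 0) (hef : B e f = 1)
    (hh : B h h = 0) (hhf : B h f = 1) :
    ∃ g ∈ isometryGroup B, g h = e ∧ ∀ y, B f y = 0 → B h y = B e y → g y = y := by
  have hfe : B f e = 1 := by rw [hB, hef]
  have hfh : B f h = 1 := by rw [hB, hhf]
  have heh : B e h = B h e := hB _ _
  set c := B h e with hc
  have haa : B (e - h + c • f) (e - h + c • f) = 2 * -c := by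
    simp only [map_sub, map_add, map_smul, LinearMap.sub_apply, LinearMap.add_apply,
      LinearMap.smul_apply, he, hf, hef, hh, hhf, hfe, hfh, heh, ← hc, smul_eq_mul]
    ring
  have hfa : B f (e - h + c • f) = 0 := by simp [hfe, hfh, hf]
  obtain ⟨g, hg, hgx⟩ := exists_eichler_transvection hB hf hfa haa
  refine ⟨g, hg, ?_, fun y hy hhy => ?_⟩
  · simp only [hgx, map_sub, map_add, map_smul, LinearMap.sub_apply, LinearMap.add_apply,
      LinearMap.smul_apply, hh, hfh, heh, smul_eq_mul]
    module
  · simp [hgx, hy, hhy]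

namespace HyperbolicPairs

variable {B : L →ₗ[ℤ] L →ₗ[ℤ] ℤ} {e₁ f₁ e₂ f₂ : L}

theorem f₁e₁ (H : HyperbolicPairs B e₁ f₁ e₂ f₂) : B f₁ e₁ = 1 := by rw [H.symm, H.e₁f₁]
theorem f₂e₂ (H : HyperbolicPairs B e₁ f₁ e₂ f₂) : B f₂ e₂ = 1 := by rw [H.symm, H.e₂f₂]
theorem e₂e₁ (H : HyperbolicPairs B e₁ f₁ e₂ f₂) : B e₂ e₁ = 0 := by rw [H.symm, H.e₁e₂]
theorem f₂e₁ (H : HyperbolicPairs B e₁ f₁ e₂ f₂) : B f₂ e₁ = 0 := by rw [H.symm, H.e₁f₂]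
theorem e₂f₁ (H : HyperbolicPairs B e₁ f₁ e₂ f₂) : B e₂ f₁ = 0 := by rw [H.symm, H.f₁e₂]
theorem f₂f₁ (H : HyperbolicPairs B e₁ f₁ e₂ f₂) : B f₂ f₁ = 0 := by rw [H.symm, H.f₁f₂]

theorem swap_right (H : HyperbolicPairs B e₁ f₁ e₂ f₂) : HyperbolicPairs B e₁ f₁ f₂ e₂ :=
  ⟨H.symm, H.even, H.e₁e₁, H.f₁f₁, H.e₁f₁, H.f₂f₂, H.e₂e₂, H.f₂e₂, H.e₁f₂, H.e₁e₂, H.f₁f₂, H.f₁e₂⟩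

theorem swap_left (H : HyperbolicPairs B e₁ f₁ e₂ f₂) : HyperbolicPairs B f₁ e₁ e₂ f₂ :=
  ⟨H.symm, H.even, H.f₁f₁, H.e₁e₁, H.f₁e₁, H.e₂e₂, H.f₂f₂, H.e₂f₂, H.f₁e₂, H.f₁f₂, H.e₁e₂, H.e₁f₂⟩

/-- Every vector splits off its component orthogonal to both hyperbolic pairs. -/
theorem exists_orthogonal_component (H : HyperbolicPairs B e₁ f₁ e₂ f₂) (x : L) :
    ∃ w, x = w + (B x f₁ • e₁ + B x e₁ • f₁ + B x f₂ • e₂ + B x e₂ • f₂) ∧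
      B w e₁ = 0 ∧ B w f₁ = 0 ∧ B w e₂ = 0 ∧ B w f₂ = 0 := by
  refine ⟨x - (B x f₁ • e₁ + B x e₁ • f₁ + B x f₂ • e₂ + B x e₂ • f₂), by abel, ?_, ?_, ?_, ?_⟩ <;>
  simp [H.e₁e₁, H.f₁f₁, H.e₁f₁, H.e₂e₂, H.f₂f₂, H.e₂f₂, H.e₁e₂, H.e₁f₂, H.f₁e₂, H.f₁f₂,
    H.f₁e₁, H.f₂e₂, H.e₂e₁, H.f₂e₁, H.e₂f₁, H.f₂f₁]

theorem exists_isometry_e₂_f₁ (H : HyperbolicPairs B e₁ f₁ e₂ f₂) :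
    ∃ g ∈ isometryGroup B, g e₂ = f₁ := by
  have hh : B (f₁ + e₂) (f₁ + e₂) = 0 := by simp [H.f₁f₁, H.f₁e₂, H.e₂f₁, H.e₂e₂]
  obtain ⟨g, hg, hgf, -⟩ := exists_isometry_of_pairing_eq_one H.symm H.f₁f₁ H.e₁e₁ H.f₁e₁
    hh (by simp [H.f₁e₁, H.e₂e₁])
  obtain ⟨k, hk, hke, -⟩ := exists_isometry_of_pairing_eq_one H.symm H.e₂e₂ H.f₂f₂ H.e₂f₂
    hh (by simp [H.f₁f₂, H.e₂f₂])
  refine ⟨g * k⁻¹, mul_mem hg (inv_mem hk), ?_⟩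
  rw [← hke, ← LinearEquiv.mul_apply, inv_mul_cancel_right, hgf]

/-- An isotropic vector having pairing `1` with `f₂` lies in the orbit of `f₁`. -/
theorem exists_isometry_f₁_of_f₂ (H : HyperbolicPairs B e₁ f₁ e₂ f₂) {h : L} (hh : B h h = 0)
    (hhf : B h f₂ = 1) : ∃ g ∈ isometryGroup B, g h = f₁ := by
  obtain ⟨g, hg, hgh, -⟩ :=
    exists_isometry_of_pairing_eq_one H.symm H.e₂e₂ H.f₂f₂ H.e₂f₂ hh hhf
  obtain ⟨k, hk, hke⟩ := H.exists_isometry_e₂_f₁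
  exact ⟨k * g, mul_mem hk hg, by rw [LinearEquiv.mul_apply, hgh, hke]⟩

/-- An isotropic vector having pairing `1` with `f₁` lies in the orbit of `f₁`. -/
theorem exists_isometry_f₁_of_f₁ (H : HyperbolicPairs B e₁ f₁ e₂ f₂) {h : L} (hh : B h h = 0)
    (hhf : B h f₁ = 1) : ∃ g ∈ isometryGroup B, g h = f₁ := by
  obtain ⟨g, hg, hgh, -⟩ :=
    exists_isometry_of_pairing_eq_one H.symm H.e₁e₁ H.f₁f₁ H.e₁f₁ hh hhf
  obtain ⟨k, hk, hke⟩ := H.swap_left.exists_isometry_e₂_f₁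
  obtain ⟨l, hl, hle⟩ := H.exists_isometry_e₂_f₁
  refine ⟨l * k⁻¹ * g, mul_mem (mul_mem hl (inv_mem hk)) hg, ?_⟩
  rw [LinearEquiv.mul_apply, hgh, ← hke, ← LinearEquiv.mul_apply, inv_mul_cancel_right, hle]

/-- If no nonzero remainder modulo `d = B(v, f₁)` is the pairing of `v` with a vector in the
orbit of `f₁`, then `d` divides every pairing with `v`. -/
theorem dvd_of_minimal (H : HyperbolicPairs B e₁ f₁ e₂ f₂) {v : L}
    (hmin : ∀ h, (∃ g ∈ isometryGroup B, g h = f₁) → B v h % B v f₁ = B v h → B v h = 0)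
    (x : L) : B v f₁ ∣ B v x := by
  have key : ∀ p, (∀ k, ∃ h, (∃ g ∈ isometryGroup B, g h = f₁) ∧ B v h = p + B v f₁ * k) →
      B v f₁ ∣ p := by
    intro p hp
    obtain ⟨h, hh, hvh⟩ := hp (-(p / B v f₁))
    have hmod : B v h = p % B v f₁ := by rw [hvh, Int.emod_def]; ring
    exact Int.dvd_of_emod_eq_zero (hmod ▸ hmin h hh (by rw [hmod, Int.emod_emod]))
  have hf₂ : B v f₁ ∣ B v f₂ := key _ fun k =>
    ⟨f₂ + k • f₁, H.swap_right.exists_isometry_f₁_of_f₂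
      (by simp [H.f₂f₂, H.f₂f₁, H.f₁f₂, H.f₁f₁]) (by simp [H.f₂e₂, H.f₁e₂]),
      by simp [mul_comm]⟩
  have he₂ : B v f₁ ∣ B v e₂ := key _ fun k =>
    ⟨e₂ + k • f₁, H.exists_isometry_f₁_of_f₂
      (by simp [H.e₂e₂, H.e₂f₁, H.f₁e₂, H.f₁f₁]) (by simp [H.e₂f₂, H.f₁f₂]),
      by simp [mul_comm]⟩
  have he₁ : B v f₁ ∣ B v e₁ := by
    obtain ⟨p, hp⟩ := he₂
    obtain ⟨q, hq⟩ := hf₂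
    refine key _ fun k => ?_
    obtain ⟨j, hj⟩ : ∃ j, j = (p + 1) * q - k := ⟨_, rfl⟩
    refine ⟨e₁ + j • e₂ + (p + 1) • f₂ - ((p + 1) * j) • f₁,
      H.exists_isometry_f₁_of_f₁ ?_ ?_, ?_⟩
    · simp only [map_sub, map_add, map_smul, LinearMap.sub_apply, LinearMap.add_apply,
        LinearMap.smul_apply, H.e₁e₁, H.f₁f₁, H.e₁f₁, H.e₂e₂, H.f₂f₂, H.e₂f₂, H.e₁e₂, H.e₁f₂,
        H.f₁e₂, H.f₁f₂, H.f₁e₁, H.f₂e₂, H.e₂e₁, H.f₂e₁, H.e₂f₁, H.f₂f₁, smul_eq_mul]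
      ring
    · simp [H.e₁f₁, H.e₂f₁, H.f₂f₁, H.f₁f₁]
    · simp only [map_sub, map_add, map_smul, hp, hq, smul_eq_mul]
      rw [hj]
      ring
  obtain ⟨w, hw, hwe₁, hwf₁, hwe₂, hwf₂⟩ := H.exists_orthogonal_component x
  have hvw : B v f₁ ∣ B v w := by
    obtain ⟨n, hn⟩ := H.even w
    have h : B v f₁ ∣ B v e₂ + B v w - n * B v f₂ := key _ fun k =>
      ⟨e₂ + w - n • f₂ + k • f₁, H.exists_isometry_f₁_of_f₂
        (by
          simp only [map_sub, map_add, map_smul, LinearMap.sub_apply, LinearMap.add_apply,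
            LinearMap.smul_apply, H.f₁f₁, H.e₂e₂, H.f₂f₂, H.e₂f₂, H.f₁e₂, H.f₁f₂, H.f₂e₂, H.e₂f₁,
            H.f₂f₁, H.symm _ w, hwf₁, hwe₂, hwf₂, hn, smul_eq_mul]
          ring)
        (by simp [H.e₂f₂, H.f₂f₂, H.f₁f₂, hwf₂]), by simp [mul_comm]⟩
    have h' := (h.add (hf₂.mul_left n)).sub he₂
    rwa [show B v e₂ + B v w - n * B v f₂ + n * B v f₂ - B v e₂ = B v w by ring] at h'
  rw [hw]
  simp only [map_add, map_smul, smul_eq_mul]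
  exact hvw.add ((((he₁.mul_left _).add (dvd_mul_left _ _)).add (he₂.mul_left _)).add
    (hf₂.mul_left _))

/-- Isotropic vectors of divisibility one form a single orbit. -/
theorem exists_isometry_f₁_of_isotropic (H : HyperbolicPairs B e₁ f₁ e₂ f₂) {v : L}
    (hv : B v v = 0) (hdiv : ∀ d, (∀ x, d ∣ B v x) → IsUnit d) :
    ∃ g ∈ isometryGroup B, g v = f₁ := by
  classical
  have hex : ∃ n : ℕ, n ≠ 0 ∧ ∃ h, (∃ g ∈ isometryGroup B, g h = f₁) ∧ (B v h).natAbs = n := by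
    by_contra hcon
    have hzero : ∀ h, (∃ g ∈ isometryGroup B, g h = f₁) → B v h = 0 := by
      intro h hh
      by_contra hne
      exact hcon ⟨_, Int.natAbs_ne_zero.2 hne, h, hh, rfl⟩
    have hf : B v f₁ = 0 := hzero f₁ ⟨1, one_mem _, rfl⟩
    have hunit := hdiv 0 fun x => hf ▸ H.dvd_of_minimal (fun h hh _ => hzero h hh) x
    exact not_isUnit_zero hunit
  obtain ⟨hn0, h, ⟨g, hg, hgh⟩, hn⟩ := Nat.find_spec hex
  have hgv : B (g v) f₁ = B v h := by rw [← hgh, hg]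
  have hdvd : ∀ x, B (g v) f₁ ∣ B (g v) x := by
    refine H.dvd_of_minimal fun h' ⟨k, hk, hkh⟩ hmod => ?_
    by_contra hne
    have hvh : B v (g⁻¹ h') = B (g v) h' := by
      rw [← hg]
      simp
    refine Nat.find_min hex (m := (B (g v) h').natAbs) ?_ ⟨Int.natAbs_ne_zero.2 hne, g⁻¹ h',
      ⟨k * g, mul_mem hk hg, by simpa using hkh⟩, by rw [hvh]⟩
    have hd0 : B (g v) f₁ ≠ 0 := by
      rw [hgv]
      exact Int.natAbs_ne_zero.1 (hn ▸ hn0)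
    have h1 := Int.emod_nonneg (B (g v) h') hd0
    have h2 := Int.emod_lt_abs (B (g v) h') hd0
    rw [hmod] at h1 h2
    rw [hgv, Int.abs_eq_natAbs] at h2
    omega
  have hunit : IsUnit (B (g v) f₁) := hdiv _ fun x => by
    rw [← hg v x]
    exact hdvd _
  have hgg : B (g v) (g v) = 0 := by rw [hg, hv]
  rcases Int.isUnit_iff.1 hunit with h1 | h1
  · obtain ⟨k, hk, hkv⟩ := H.exists_isometry_f₁_of_f₁ hgg h1
    exact ⟨k * g, mul_mem hk hg, hkv⟩
  · obtain ⟨k, hk, hkv⟩ := H.exists_isometry_f₁_of_f₁ (h := -g v) (by simpa using hgg)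
      (by simp [h1])
    have hneg : LinearEquiv.neg ℤ ∈ isometryGroup B := fun x y => by simp
    exact ⟨k * LinearEquiv.neg ℤ * g, mul_mem (mul_mem hk hneg) hg, by simpa using hkv⟩

theorem exists_isometry_fixing_e₁_of_odd (H : HyperbolicPairs B e₁ f₁ e₂ f₂) {f : L}
    (hff : B f f = 0) (hef : B e₁ f = 2) (hodd : Odd (B f f₂)) :
    ∃ g ∈ isometryGroup B, g e₁ = e₁ ∧ g f = (2 : ℤ) • f₁ + e₂ := by
  obtain ⟨m, hm⟩ := hodd
  obtain ⟨g, hg, hgx⟩ := exists_eichler_transvection H.symm (a := -m • e₂) (n := 0) H.e₁e₁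
    (by simp [H.e₁e₂]) (by simp [H.e₂e₂])
  have hge : g e₁ = e₁ := by simp [hgx, H.e₂e₁, H.e₁e₁]
  have hgf : B (g f) f₂ = 1 := by
    simp only [hgx, map_sub, map_add, map_smul, LinearMap.sub_apply, LinearMap.add_apply,
      LinearMap.smul_apply, H.e₁f₂, H.e₂f₂, hef, hm, smul_eq_mul]
    ring
  have hgfe : B (g f) e₁ = 2 := by rw [← hge, hg, H.symm, hef]
  obtain ⟨k, hk, hkf, hfix⟩ := exists_isometry_of_pairing_eq_one H.symm
    (e := (2 : ℤ) • f₁ + e₂) (by simp [H.f₁f₁, H.f₁e₂, H.e₂f₁, H.e₂e₂]) H.f₂f₂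
    (by simp [H.f₁f₂, H.e₂f₂]) (by rw [hg, hff]) hgf
  refine ⟨k * g, mul_mem hk hg, ?_, hkf⟩
  rw [LinearEquiv.mul_apply, hge]
  exact hfix e₁ H.f₂e₁ (by simp [hgfe, H.f₁e₁, H.e₂e₁])

theorem exists_isometry_fixing_e₁ (H : HyperbolicPairs B e₁ f₁ e₂ f₂) {f x : L}
    (hff : B f f = 0) (hef : B e₁ f = 2) (hex : Even (B e₁ x)) (hfx : Odd (B f x)) :
    ∃ g ∈ isometryGroup B, g e₁ = e₁ ∧ g f = (2 : ℤ) • f₁ + e₂ := by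
  suffices h : ∃ g ∈ isometryGroup B, g e₁ = e₁ ∧ Odd (B (g f) f₂) by
    obtain ⟨g, hg, hge, hgf⟩ := h
    obtain ⟨k, hk, hke, hkf⟩ := H.exists_isometry_fixing_e₁_of_odd (f := g f) (by rw [hg, hff])
      (by rw [← hge, hg, hef]) hgf
    exact ⟨k * g, mul_mem hk hg, by rw [LinearEquiv.mul_apply, hge, hke], hkf⟩
  by_cases hf₂ : Odd (B f f₂)
  · exact ⟨1, one_mem _, rfl, hf₂⟩
  by_cases he₂ : Odd (B f e₂)
  · obtain ⟨g, hg, hgx⟩ := exists_reflection H.symm (r := e₂ - f₂)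
      (by simp [H.e₂e₂, H.e₂f₂, H.f₂e₂, H.f₂f₂])
    refine ⟨g, hg, by simp [hgx, H.e₂e₁, H.f₂e₁], ?_⟩
    have hge : g e₂ = f₂ := by simp [hgx, H.e₂e₂, H.f₂e₂]
    rwa [← hge, hg]
  obtain ⟨w, hw, hwe₁, hwf₁, hwe₂, hwf₂⟩ := H.exists_orthogonal_component x
  obtain ⟨n, hn⟩ := H.even w
  have hfw : Odd (B f w) := by
    rw [Int.not_odd_iff_even] at hf₂ he₂
    have h := congrArg (B f) hw
    simp only [map_add, map_smul, smul_eq_mul, H.symm f e₁, hef, H.symm x e₁] at h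
    rw [h] at hfx
    have h' := ((((even_two.mul_left (B x f₁)).add (hex.mul_right (B f f₁))).add
      (he₂.mul_left (B x f₂))).add (hf₂.mul_left (B x e₂)))
    exact (Int.odd_add.1 hfx).2 h'
  obtain ⟨g, hg, hgh, hfix⟩ := exists_isometry_of_pairing_eq_one H.symm (e := f₂) (f := e₂)
    (h := f₂ + w - n • e₂) H.f₂f₂ H.e₂e₂ H.f₂e₂
    (by
      simp only [map_sub, map_add, map_smul, LinearMap.sub_apply, LinearMap.add_apply,
        LinearMap.smul_apply, H.e₂e₂, H.f₂f₂, H.e₂f₂, H.f₂e₂, H.symm _ w, hwe₂, hwf₂, hn,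
        smul_eq_mul]
      ring)
    (by simp [H.f₂e₂, hwe₂, H.e₂e₂])
  refine ⟨g, hg, hfix e₁ H.e₂e₁ (by simp [H.f₂e₁, hwe₁, H.e₂e₁]), ?_⟩
  rw [← hgh, hg]
  rw [Int.not_odd_iff_even] at hf₂ he₂
  simp only [map_sub, map_add, map_smul, smul_eq_mul]
  exact (hf₂.add_odd hfw).sub_even (he₂.mul_left n)

/-- Pairs `(e, f)` of isotropic vectors with pairing `2` whose functionals are linearly independent
modulo `2` form a single orbit. -/
theorem exists_isometry_normal_form (H : HyperbolicPairs B e₁ f₁ e₂ f₂) {e f : L}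
    (hee : B e e = 0) (hff : B f f = 0) (hef : B e f = 2) (he : ∃ x, Odd (B e x))
    (hf : ∃ x, Odd (B f x)) (hadd : ∃ x, Odd (B (e + f) x)) :
    ∃ g ∈ isometryGroup B, g e = e₁ ∧ g f = (2 : ℤ) • f₁ + e₂ := by
  have hdiv : ∀ d, (∀ x, d ∣ B e x) → IsUnit d := by
    intro d hd
    obtain ⟨x, k, hk⟩ := he
    have h1 : d ∣ 1 := by
      have h := (hd x).sub ((hd f).mul_right k)
      rwa [hef, hk, add_sub_cancel_left] at h
    exact isUnit_of_dvd_one h1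
  obtain ⟨x, hex, hfx⟩ : ∃ x, Even (B e x) ∧ Odd (B f x) := by
    obtain ⟨x, hx⟩ := hf
    obtain ⟨y, hy⟩ := hadd
    rw [map_add, LinearMap.add_apply] at hy
    by_cases hex : Even (B e x)
    · exact ⟨x, hex, hx⟩
    by_cases hey : Even (B e y)
    · exact ⟨y, hey, by grind⟩
    · refine ⟨x + y, ?_, ?_⟩ <;> rw [map_add] <;> grind
  obtain ⟨g, hg, hge⟩ := H.swap_left.exists_isometry_f₁_of_isotropic hee hdiv
  obtain ⟨k, hk, hke, hkf⟩ := H.exists_isometry_fixing_e₁ (f := g f) (x := g x)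
    (by rw [hg, hff]) (by rw [← hge, hg, hef]) (by rwa [← hge, hg]) (by rwa [hg])
  exact ⟨k * g, mul_mem hk hg, by rw [LinearEquiv.mul_apply, hge, hke], hkf⟩

end HyperbolicPairs

end Isometries

section Lambda

theorem gramBilin_apply {n : ℕ} (G : Matrix (Fin n) (Fin n) ℤ) (x y : Fin n → ℤ) :
    gramBilin G x y = ∑ i, ∑ j, x i * G i j * y j := by
  rw [gramBilin, Matrix.toLinearMap₂'_apply]
  simp only [smul_eq_mul]
  exact Finset.sum_congr rfl fun i _ => Finset.sum_congr rfl fun j _ => by ring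

theorem gramBilin_symm {n : ℕ} {G : Matrix (Fin n) (Fin n) ℤ} (hG : G.IsSymm)
    (x y : Fin n → ℤ) : gramBilin G x y = gramBilin G y x := by
  rw [gramBilin_apply, gramBilin_apply, Finset.sum_comm]
  refine Finset.sum_congr rfl fun i _ => Finset.sum_congr rfl fun j _ => ?_
  rw [hG.apply]
  ring

theorem gramBilin_UGram (x y : Fin 2 → ℤ) :
    gramBilin UGram x y = x 0 * y 1 + x 1 * y 0 := by
  simp [gramBilin_apply, UGram, Fin.sum_univ_two]

theorem gramBilin_U2Gram (x y : Fin 2 → ℤ) :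
    gramBilin U2Gram x y = 2 * (x 0 * y 1 + x 1 * y 0) := by
  simp [gramBilin_apply, U2Gram, Fin.sum_univ_two]
  ring

theorem gramBilin_rankOneGram (k : ℤ) (x y : Fin 1 → ℤ) :
    gramBilin (rankOneGram k) x y = k * (x 0 * y 0) := by
  simp [gramBilin_apply, rankOneGram]
  ring

theorem gramBilin_E8Gram (x y : Fin 8 → ℤ) :
    gramBilin E8Gram x y =
      x 0 * (y 2 - 2 * y 0) + x 1 * (y 3 - 2 * y 1) + x 2 * (y 0 + y 3 - 2 * y 2) +
      x 3 * (y 1 + y 2 + y 4 - 2 * y 3) + x 4 * (y 3 + y 5 - 2 * y 4) +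
      x 5 * (y 4 + y 6 - 2 * y 5) + x 6 * (y 5 + y 7 - 2 * y 6) + x 7 * (y 6 - 2 * y 7) := by
  simp [gramBilin_apply, E8Gram, CartanMatrix.E₈, Fin.sum_univ_eight]
  ring

theorem even_gramBilin_E8Gram (x : Fin 8 → ℤ) : Even (gramBilin E8Gram x x) := by
  rw [gramBilin_E8Gram]
  refine ⟨x 0 * (x 2 - x 0) + x 1 * (x 3 - x 1) + x 2 * (x 3 - x 2) + x 3 * (x 4 - x 3) +
    x 4 * (x 5 - x 4) + x 5 * (x 6 - x 5) + x 6 * (x 7 - x 6) - x 7 * x 7, ?_⟩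
  ring

theorem even_apply_of_even_gramBilin_UGram {x : Fin 2 → ℤ} (hx : ∀ y, Even (gramBilin UGram x y))
    (i : Fin 2) : Even (x i) := by
  have h0 := hx (Pi.single 0 1)
  have h1 := hx (Pi.single 1 1)
  simp [gramBilin_UGram] at h0 h1
  fin_cases i <;> assumption

theorem even_apply_of_even_gramBilin_E8Gram {x : Fin 8 → ℤ}
    (hx : ∀ y, Even (gramBilin E8Gram x y)) (i : Fin 8) : Even (x i) := by
  have h : ∀ j, Even (gramBilin E8Gram (Pi.single j 1) x) := fun j => by
    rw [gramBilin_symm]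
    · exact hx _
    · ext i j
      fin_cases i <;> fin_cases j <;> rfl
  have h0 := h 0
  have h1 := h 1
  have h2 := h 2
  have h3 := h 3
  have h4 := h 4
  have h5 := h 5
  have h6 := h 6
  have h7 := h 7
  simp [gramBilin_E8Gram, Int.even_iff] at h0 h1 h2 h3 h4 h5 h6 h7
  fin_cases i <;> simp [Int.even_iff] <;> omega

theorem LambdaB_apply (x y : LambdaM) :
    LambdaB x y = gramBilin UGram x.1 y.1 + (gramBilin UGram x.2.1 y.2.1 +
      (gramBilin UGram x.2.2.1 y.2.2.1 + (gramBilin E8Gram x.2.2.2.1 y.2.2.2.1 +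
      (gramBilin E8Gram x.2.2.2.2.1 y.2.2.2.2.1 +
      gramBilin (rankOneGram (-2)) x.2.2.2.2.2 y.2.2.2.2.2)))) :=
  rfl

theorem LambdaB_symm (x y : LambdaM) : LambdaB x y = LambdaB y x := by
  simp only [LambdaB_apply, gramBilin_UGram, gramBilin_E8Gram, gramBilin_rankOneGram]
  ring

theorem even_LambdaB_self (x : LambdaM) : Even (LambdaB x x) := by
  have hU : ∀ y : Fin 2 → ℤ, Even (gramBilin UGram y y) := fun y =>
    ⟨y 0 * y 1, by rw [gramBilin_UGram]; ring⟩
  have hR : ∀ y : Fin 1 → ℤ, Even (gramBilin (rankOneGram (-2)) y y) := fun y =>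
    ⟨-(y 0 * y 0), by rw [gramBilin_rankOneGram]; ring⟩
  rw [LambdaB_apply]
  exact (hU _).add ((hU _).add ((hU _).add ((even_gramBilin_E8Gram _).add
    ((even_gramBilin_E8Gram _).add (hR _)))))

/-- The discriminant group of `Λ` has order two, generated by a class of square `-1/2`: a vector
pairing evenly with all of `Λ` and of square divisible by `4` is twice a vector of `Λ`. -/
theorem exists_two_smul_of_even_LambdaB {v : LambdaM} (hv : ∀ x, Even (LambdaB v x))
    (h4 : 4 ∣ LambdaB v v) : ∃ y, v = (2 : ℤ) • y := by
  obtain ⟨a, b, c, p, q, r⟩ := v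
  have halve : ∀ {n : ℕ} {x : Fin n → ℤ}, (∀ i, Even (x i)) → ∃ y, x = (2 : ℤ) • y := by
    intro n x hx
    choose y hy using hx
    exact ⟨y, funext fun i => by simp [hy i, two_mul]⟩
  obtain ⟨a, rfl⟩ := halve (even_apply_of_even_gramBilin_UGram (x := a) fun y => by
    simpa [LambdaB_apply] using hv (y, 0, 0, 0, 0, 0))
  obtain ⟨b, rfl⟩ := halve (even_apply_of_even_gramBilin_UGram (x := b) fun y => by
    simpa [LambdaB_apply] using hv (0, y, 0, 0, 0, 0))
  obtain ⟨c, rfl⟩ := halve (even_apply_of_even_gramBilin_UGram (x := c) fun y => by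
    simpa [LambdaB_apply] using hv (0, 0, y, 0, 0, 0))
  obtain ⟨p, rfl⟩ := halve (even_apply_of_even_gramBilin_E8Gram (x := p) fun y => by
    simpa [LambdaB_apply] using hv (0, 0, 0, y, 0, 0))
  obtain ⟨q, rfl⟩ := halve (even_apply_of_even_gramBilin_E8Gram (x := q) fun y => by
    simpa [LambdaB_apply] using hv (0, 0, 0, 0, y, 0))
  have hr : Even (r 0) := by
    simp only [LambdaB_apply, map_smul, LinearMap.smul_apply, smul_eq_mul,
      gramBilin_rankOneGram] at h4
    have h2 : (2 : ℤ) ∣ r 0 * r 0 := by omega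
    exact even_iff_two_dvd.2 ((Int.prime_two.dvd_or_dvd h2).elim id id)
  obtain ⟨r, rfl⟩ := halve (x := r) fun i => by rwa [Subsingleton.elim i 0]
  exact ⟨(a, b, c, p, q, r), rfl⟩

theorem exists_hyperbolicPairs_LambdaB : ∃ e₁ f₁ e₂ f₂, HyperbolicPairs LambdaB e₁ f₁ e₂ f₂ := by
  refine ⟨(![1, 0], 0, 0, 0, 0, 0), (![0, 1], 0, 0, 0, 0, 0), (0, ![1, 0], 0, 0, 0, 0),
    (0, ![0, 1], 0, 0, 0, 0), LambdaB_symm, even_LambdaB_self, ?_, ?_, ?_, ?_, ?_, ?_, ?_, ?_, ?_,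
    ?_⟩ <;> simp [LambdaB_apply, gramBilin_UGram]

/-- An involution with invariant lattice `U(2)` is determined by a standard basis `(e, f)` of this
lattice, and this basis is linearly independent modulo `2` as a pair of functionals. -/
theorem exists_basis_of_invLattice_isometricTo_U2 {ι : LambdaM ≃ₗ[ℤ] LambdaM}
    (hisom : IsIsometry ι) (hinvol : ∀ x, ι (ι x) = x)
    (hU : IsometricTo (invLattice ι) (gramBilin U2Gram)) :
    ∃ e f, LambdaB e e = 0 ∧ LambdaB f f = 0 ∧ LambdaB e f = 2 ∧
      (∃ x, Odd (LambdaB e x)) ∧ (∃ x, Odd (LambdaB f x)) ∧ (∃ x, Odd (LambdaB (e + f) x)) ∧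
      ∀ x, ι x = LambdaB x f • e + LambdaB x e • f - x := by
  obtain ⟨φ, hφ⟩ := hU
  have hmem : ∀ x, x ∈ invLattice ι ↔ ι x = x := fun x => Iff.rfl
  have hpair : ∀ u v : Fin 2 → ℤ, LambdaB (φ.symm u : LambdaM) (φ.symm v : LambdaM) =
      2 * (u 0 * v 1 + u 1 * v 0) := by
    intro u v
    rw [← hφ, φ.apply_symm_apply, φ.apply_symm_apply, gramBilin_U2Gram]
  have hodd : ∀ u : Fin 2 → ℤ, (∃ i, Odd (u i)) → ∃ x, Odd (LambdaB (φ.symm u : LambdaM) x) := by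
    rintro u ⟨i, hi⟩
    by_contra! hcon
    obtain ⟨y, hy⟩ := exists_two_smul_of_even_LambdaB
      (fun x => Int.not_odd_iff_even.1 (hcon x)) ⟨u 0 * u 1, by rw [hpair]; ring⟩
    have hyinv : ι y = y := by
      have h := (hmem _).1 (φ.symm u).2
      rw [hy, map_smul] at h
      exact smul_right_injective _ two_ne_zero h
    have hu : φ.symm u = (2 : ℤ) • (⟨y, (hmem y).2 hyinv⟩ : invLattice ι) := Subtype.ext hy
    rw [LinearEquiv.symm_apply_eq, map_smul] at hu
    rw [hu, Pi.smul_apply, smul_eq_mul] at hi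
    exact Int.not_odd_iff_even.2 (even_two_mul _) hi
  have hsum : (φ.symm ![1, 0] : LambdaM) + φ.symm ![0, 1] = φ.symm ![1, 1] := by
    rw [← Submodule.coe_add, ← map_add]
    simp
  have hιe := (hmem _).1 (φ.symm ![1, 0]).2
  have hιf := (hmem _).1 (φ.symm ![0, 1]).2
  refine ⟨φ.symm ![1, 0], φ.symm ![0, 1], by simp [hpair], by simp [hpair], by simp [hpair],
    hodd _ ⟨0, by simp⟩, hodd _ ⟨1, by simp⟩, hsum ▸ hodd _ ⟨0, by simp⟩, fun x => ?_⟩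
  have hx : ι (x + ι x) = x + ι x := by rw [map_add, hinvol, add_comm]
  obtain ⟨u, hu⟩ : ∃ u, (φ.symm u : LambdaM) = x + ι x :=
    ⟨φ ⟨_, (hmem _).2 hx⟩, by rw [φ.symm_apply_apply]⟩
  have hue : (φ.symm u : LambdaM) = u 0 • (φ.symm ![1, 0] : LambdaM) + u 1 • φ.symm ![0, 1] := by
    rw [← Submodule.coe_smul, ← Submodule.coe_smul, ← Submodule.coe_add, ← map_smul, ← map_smul,
      ← map_add]
    congr 2
    ext i
    fin_cases i <;> simp
  have h1 : LambdaB x (φ.symm ![1, 0]) = u 1 := by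
    have h := hpair u ![1, 0]
    have h' := hisom x (φ.symm ![1, 0])
    rw [hιe] at h'
    rw [hu, map_add, LinearMap.add_apply, h'] at h
    simp at h
    omega
  have h0 : LambdaB x (φ.symm ![0, 1]) = u 0 := by
    have h := hpair u ![0, 1]
    have h' := hisom x (φ.symm ![0, 1])
    rw [hιf] at h'
    rw [hu, map_add, LinearMap.add_apply, h'] at h
    simp at h
    omega
  rw [h0, h1, ← hue, hu, add_sub_cancel_left]

end Lambda

/-- Two involutions of `Λ = U³ ⊕ E8² ⊕ ⟨−2⟩` whose invariant sublattices are both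
isometric to `U(2)` are conjugate in `O(Λ)`. -/
theorem conjugacy_case_U2
    (ι ι' : LambdaM ≃ₗ[ℤ] LambdaM)
    (hisom : IsIsometry ι) (hinvol : ∀ x, ι (ι x) = x)
    (hisom' : IsIsometry ι') (hinvol' : ∀ x, ι' (ι' x) = x)
    (hU : IsometricTo (invLattice ι) (gramBilin U2Gram))
    (hU' : IsometricTo (invLattice ι') (gramBilin U2Gram)) :
    ConjInO ι ι' := by
  obtain ⟨e₁, f₁, e₂, f₂, H⟩ := exists_hyperbolicPairs_LambdaB
  obtain ⟨e, f, hee, hff, hef, he, hf, hadd, hι⟩ :=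
    exists_basis_of_invLattice_isometricTo_U2 hisom hinvol hU
  obtain ⟨e', f', hee', hff', hef', he', hf', hadd', hι'⟩ :=
    exists_basis_of_invLattice_isometricTo_U2 hisom' hinvol' hU'
  obtain ⟨g, hg, hge, hgf⟩ := H.exists_isometry_normal_form hee hff hef he hf hadd
  obtain ⟨k, hk, hke, hkf⟩ := H.exists_isometry_normal_form hee' hff' hef' he' hf' hadd'
  have hγ : k⁻¹ * g ∈ isometryGroup LambdaB := mul_mem (inv_mem hk) hg
  have hγe : (k⁻¹ * g) e = e' := by
    rw [LinearEquiv.mul_apply, hge, ← hke, ← LinearEquiv.mul_apply, inv_mul_cancel]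
    rfl
  have hγf : (k⁻¹ * g) f = f' := by
    rw [LinearEquiv.mul_apply, hgf, ← hkf, ← LinearEquiv.mul_apply, inv_mul_cancel]
    rfl
  generalize k⁻¹ * g = γ at hγ hγe hγf
  refine ⟨γ, hγ, fun x => ?_⟩
  rw [hι, hι', map_sub, map_add, map_smul, map_smul, γ.apply_symm_apply, hγe, hγf,
    ← hγ (γ.symm x) f, ← hγ (γ.symm x) e, γ.apply_symm_apply, hγe, hγf]
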